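/- arXiv:2102.04793 — 3 statements merged into one kernel-verified Lean document; each statement's English description precedes it below -/
import Mathlib

section
/- Let T̄ be an upper transition operator on ℒ(X) and let S be a communication class of 𝒢(T̄) that is closed. Then for every f ∈ ℒ(X) and every x ∈ S: (i) (1/k)·[T̄_f^k(0)](x) = (1/k)·[T̄_{f·𝟙_S}^k(0)](x) for every k ≥ 1, where f·𝟙_S is the pointwise product; and (ii) the limit lim_{k→∞} (1/k)·[T̄_f^k(0)](x) exists and is the same for all x ∈ S. -/
open Filter Topology

namespace WeakErg

variable {X : Type*} [Fintype X] [Nonempty X]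

/-- Indicator function of a set, as a real-valued function. -/
noncomputable def ind (A : Set X) : X → ℝ := A.indicator 1

/-- Upper transition operator axioms: dominated by the max, sub-additive,
non-negatively homogeneous. -/
def IsUTO (T : (X → ℝ) → (X → ℝ)) : Prop :=
  (∀ (h : X → ℝ) (x : X), T h x ≤ ⨆ y, h y) ∧
  (∀ (h g : X → ℝ) (x : X), T (h + g) x ≤ T h x + T g x) ∧
  (∀ (l : ℝ), 0 ≤ l → ∀ h : X → ℝ, T (l • h) = l • T h)

/-- The topical map `T̄_f : h ↦ f + T̄ h`. -/
def Tf (T : (X → ℝ) → (X → ℝ)) (f : X → ℝ) : (X → ℝ) → (X → ℝ) :=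
  fun h => f + T h

/-- Edge relation of the (upper) accessibility graph 𝒢(T): an edge from `x` to `y`
iff `[T 𝟙_y](x) > 0`. -/
def Edge (T : (X → ℝ) → (X → ℝ)) (x y : X) : Prop := 0 < T (ind {y}) x

/-- Accessibility: `x = y` or there is a directed path from `x` to `y`. -/
def Acc' (T : (X → ℝ) → (X → ℝ)) : X → X → Prop := Relation.ReflTransGen (Edge T)

/-- `x` and `y` communicate. -/
def Comm (T : (X → ℝ) → (X → ℝ)) (x y : X) : Prop := Acc' T x y ∧ Acc' T y x

/-- `S` is a communication class: an equivalence class of the communication relation. -/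
def IsCommClass (T : (X → ℝ) → (X → ℝ)) (S : Set X) : Prop :=
  ∃ x : X, S = {y | Comm T x y}

/-- A nonempty set `S` is closed in 𝒢(T): no state outside `S` is accessible from `S`. -/
def ClosedIn (T : (X → ℝ) → (X → ℝ)) (S : Set X) : Prop :=
  S.Nonempty ∧ ∀ x ∈ S, ∀ y ∉ S, ¬ Acc' T x y

/-- 𝒢(T) is strongly connected. -/
def StronglyConnected (T : (X → ℝ) → (X → ℝ)) : Prop := ∀ x y : X, Acc' T x y

/-- A set `S` is absorbing for `T`: from each state outside `S` the `k`-step upper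
probability of staying outside `S` drops below 1 for some `k`. -/
def Absorbing (T : (X → ℝ) → (X → ℝ)) (S : Set X) : Prop :=
  ∀ x ∉ S, ∃ k : ℕ, T^[k] (ind Sᶜ) x < 1

/-- `R` is a top class of 𝒢(T): a communication class accessible from every state. -/
def IsTopClass (T : (X → ℝ) → (X → ℝ)) (R : Set X) : Prop :=
  IsCommClass T R ∧ ∀ x : X, ∀ y ∈ R, Acc' T x y

/-- (TCA): 𝒢(T) has a top class that is absorbing. -/
def TCA (T : (X → ℝ) → (X → ℝ)) : Prop :=
  ∃ R : Set X, IsTopClass T R ∧ Absorbing T R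

/-- `T` is weakly ergodic: for every `f`, the upper expected time averages
`(1/k)·[T̄_f^k(0)](x)` converge to a limit independent of `x`. -/
def WeaklyErgodic (T : (X → ℝ) → (X → ℝ)) : Prop :=
  ∀ f : X → ℝ, ∃ μ : ℝ, ∀ x : X,
    Tendsto (fun k : ℕ => (1 / (k : ℝ)) * (Tf T f)^[k] 0 x) atTop (𝓝 μ)

/-- `μ` is an additive eigenvalue of `G`. -/
def IsAddEigenvalue (G : (X → ℝ) → (X → ℝ)) (μ : ℝ) : Prop :=
  ∃ h : X → ℝ, G h = h + fun _ => μ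

/-- A transition matrix on `X`: nonnegative entries with rows summing to one. -/
structure TransMat (Y : Type*) [Fintype Y] where
  P : Y → Y → ℝ
  nonneg : ∀ x y, 0 ≤ P x y
  rowSum : ∀ x, ∑ y, P x y = 1

/-- The action of a transition matrix on functions. -/
def TransMat.apply (T : TransMat X) (h : X → ℝ) : X → ℝ :=
  fun x => ∑ y, T.P x y * h y

/-- A set of transition matrices is separately specified. -/
def SepSpec (𝒯 : Set (TransMat X)) : Prop :=
  ∀ T₁ ∈ 𝒯, ∀ T₂ ∈ 𝒯, ∀ A : Set X, ∃ T₃ ∈ 𝒯,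
    (∀ x ∈ A, T₃.P x = T₁.P x) ∧ (∀ y ∉ A, T₃.P y = T₂.P y)

/-- `Tbar` is the upper envelope of the set `𝒯` of transition matrices. -/
def IsUpperEnv (𝒯 : Set (TransMat X)) (Tbar : (X → ℝ) → (X → ℝ)) : Prop :=
  ∀ (h : X → ℝ) (x : X), Tbar h x = ⨆ T : 𝒯, TransMat.apply T.1 h x

/-- The repetition-independent upper expected time average
`sup_{T ∈ 𝒯} (1/k)·[T_f^k(0)](x)`. -/
noncomputable def riSeq (𝒯 : Set (TransMat X)) (f : X → ℝ) (x : X) (k : ℕ) : ℝ :=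
  ⨆ T : 𝒯, (1 / (k : ℝ)) * (Tf (TransMat.apply T.1) f)^[k] 0 x

/-- Weak ergodicity of the imprecise Markov chain under repetition independence. -/
def RIWeaklyErgodic (𝒯 : Set (TransMat X)) : Prop :=
  ∀ f : X → ℝ, ∃ μ : ℝ, ∀ x : X, Tendsto (riSeq 𝒯 f x) atTop (𝓝 μ)

end WeakErg

namespace WeakErg

section helpers
variable {X : Type*} [Fintype X] [Nonempty X]

lemma uto_zero {T : (X → ℝ) → (X → ℝ)} (hT : IsUTO T) : T 0 = 0 := by
  have := hT.2.2 0 le_rfl 0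
  simpa using this

lemma uto_sum {T : (X → ℝ) → (X → ℝ)} (hT : IsUTO T) (F : X → X → ℝ) (x : X) (s : Finset X) :
    T (∑ y ∈ s, F y) x ≤ ∑ y ∈ s, T (F y) x := by
  classical
  induction s using Finset.induction_on with
  | empty => simp [uto_zero hT]
  | insert a s ha ih =>
    rw [Finset.sum_insert ha, Finset.sum_insert ha]
    have := hT.2.1 (F a) (∑ y ∈ s, F y) x
    linarith

lemma uto_const {T : (X → ℝ) → (X → ℝ)} (hT : IsUTO T) {h : X → ℝ} {c : ℝ}
    (hc : ∀ y, h y ≤ c) (x : X) : T h x ≤ c :=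
  (hT.1 h x).trans (ciSup_le hc)

lemma uto_nonpos {T : (X → ℝ) → (X → ℝ)} (hT : IsUTO T) {S : Set X} (hcl : ClosedIn T S)
    {h : X → ℝ} (hh : ∀ y ∈ S, h y ≤ 0) {x : X} (hx : x ∈ S) : T h x ≤ 0 := by
  classical
  let c : X → ℝ := fun y => max (h y) 0
  let g : X → ℝ := ∑ y, c y • ind {y}
  have hg : ∀ z, g z = c z := by
    intro z
    simp [g, ind, Finset.sum_apply, Pi.single_apply]
  have h1 : T g x ≤ 0 := by
    refine (uto_sum hT (fun y => c y • ind {y}) x Finset.univ).trans ?_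
    refine Finset.sum_nonpos fun y _ => ?_
    rw [hT.2.2 (c y) (le_max_right _ _)]
    by_cases hy : y ∈ S
    · have : c y = 0 := max_eq_right (hh y hy)
      simp [this]
    · have hn : ¬ 0 < T (ind {y}) x := fun he =>
        hcl.2 x hx y hy (Relation.ReflTransGen.single he)
      exact mul_nonpos_of_nonneg_of_nonpos (le_max_right _ _) (not_lt.1 hn)
  have h2 : T (h - g) x ≤ 0 := uto_const hT (fun y => by
    have := le_max_left (h y) 0
    simp only [Pi.sub_apply, hg, c]; linarith) x
  have h3 := hT.2.1 (h - g) g x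
  rw [sub_add_cancel] at h3
  linarith

lemma uto_mono {T : (X → ℝ) → (X → ℝ)} (hT : IsUTO T) {S : Set X} (hcl : ClosedIn T S)
    {h g : X → ℝ} {c : ℝ} (hh : ∀ y ∈ S, h y ≤ g y + c) : ∀ x ∈ S, T h x ≤ T g x + c := by
  intro x hx
  have h1 : T (fun y => h y - g y - c) x ≤ 0 :=
    uto_nonpos hT hcl (fun y hy => by have := hh y hy; linarith) hx
  have h2 : T (fun _ => c) x ≤ c := uto_const hT (fun _ => le_rfl) x
  have h3 := hT.2.1 (fun y => h y - g y - c) (fun _ => c) x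
  have h4 := hT.2.1 g ((fun y => h y - g y - c) + (fun _ => c)) x
  have e : g + ((fun y => h y - g y - c) + (fun _ => c)) = h := by
    funext y; simp
  rw [e] at h4
  linarith

lemma iter_mono {T : (X → ℝ) → (X → ℝ)} (hT : IsUTO T) {S : Set X} (hcl : ClosedIn T S)
    {f f' h g : X → ℝ} {c : ℝ} (hf : ∀ y ∈ S, f y = f' y) (hh : ∀ y ∈ S, h y ≤ g y + c) (k : ℕ) :
    ∀ x ∈ S, (Tf T f)^[k] h x ≤ (Tf T f')^[k] g x + c := by
  induction k with
  | zero => simpa using hh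
  | succ k ih =>
    intro x hx
    rw [Function.iterate_succ_apply', Function.iterate_succ_apply']
    have := uto_mono hT hcl ih x hx
    have := hf x hx
    simp only [Tf, Pi.add_apply] at *
    linarith

lemma iter_step {T : (X → ℝ) → (X → ℝ)} (hT : IsUTO T) {S : Set X} (hcl : ClosedIn T S)
    {f : X → ℝ} {F : ℝ} (hF : ∀ y, |f y| ≤ F) (k : ℕ) (x : X) (hx : x ∈ S) :
    (Tf T f)^[k+1] 0 x ≤ (Tf T f)^[k] 0 x + F ∧ (Tf T f)^[k] 0 x ≤ (Tf T f)^[k+1] 0 x + F := by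
  rw [Function.iterate_succ_apply]
  have e : Tf T f 0 = f := by simp [Tf, uto_zero hT]
  rw [e]
  refine ⟨iter_mono hT hcl (fun _ _ => rfl) (fun y _ => ?_) k x hx,
    iter_mono hT hcl (fun _ _ => rfl) (fun y _ => ?_) k x hx⟩
  · have := abs_le.1 (hF y); simp; linarith
  · have := abs_le.1 (hF y); simp; linarith

lemma edge_bound {T : (X → ℝ) → (X → ℝ)} (hT : IsUTO T) {S : Set X} (hcl : ClosedIn T S)
    {f : X → ℝ} {F : ℝ} (hF : ∀ y, |f y| ≤ F) {x y : X} (hx : x ∈ S) (hy : y ∈ S)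
    (k : ℕ) (m : ℝ) (hm : ∀ z ∈ S, m ≤ (Tf T f)^[k] 0 z) :
    ((Tf T f)^[k] 0 y - m) * T (ind {y}) x ≤ ((Tf T f)^[k] 0 x - m) + 2 * F := by
  classical
  have h0 : 0 ≤ (Tf T f)^[k] 0 y - m := by have := hm y hy; linarith
  have h1 := uto_mono hT hcl (h := ((Tf T f)^[k] 0 y - m) • ind {y}) (g := (Tf T f)^[k] 0)
    (c := -m) (fun z hz => by
      have := hm z hz
      by_cases e : z = y
      · subst e; simp [ind, sub_eq_add_neg]
      · simp [ind, e]; linarith) x hx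
  rw [hT.2.2 _ h0] at h1
  have h2 := (iter_step hT hcl hF k x hx).1
  rw [Function.iterate_succ_apply'] at h2
  have h3 := abs_le.1 (hF x)
  simp only [Tf, Pi.add_apply, Pi.smul_apply, smul_eq_mul] at *
  linarith

lemma acc_bound {T : (X → ℝ) → (X → ℝ)} (hT : IsUTO T) {S : Set X} (hcl : ClosedIn T S)
    {f : X → ℝ} {F : ℝ} (hF : ∀ y, |f y| ≤ F) {x y : X} (hx : x ∈ S) (h : Acc' T x y) :
    ∃ A B : ℝ, ∀ (k : ℕ) (m : ℝ), (∀ z ∈ S, m ≤ (Tf T f)^[k] 0 z) →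
      (Tf T f)^[k] 0 y - m ≤ A * ((Tf T f)^[k] 0 x - m) + B := by
  induction h with
  | refl => exact ⟨1, 0, fun k m _ => by simp⟩
  | @tail b c hb hbc ih =>
    obtain ⟨A, B, ih⟩ := ih
    have hbS : b ∈ S := by
      by_contra hn; exact hcl.2 x hx b hn hb
    have hcS : c ∈ S := by
      by_contra hn; exact hcl.2 x hx c hn (hb.tail hbc)
    have hp : 0 < T (ind {c}) b := hbc
    refine ⟨A / T (ind {c}) b, (B + 2 * F) / T (ind {c}) b, fun k m hm => ?_⟩
    have h1 := ih k m hm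
    have h2 := edge_bound hT hcl hF hbS hcS k m hm
    rw [div_mul_eq_mul_div, ← add_div, le_div_iff₀ hp]
    linarith

lemma osc_bound {T : (X → ℝ) → (X → ℝ)} (hT : IsUTO T) {S : Set X}
    (hS : IsCommClass T S) (hcl : ClosedIn T S)
    {f : X → ℝ} {F : ℝ} (hF : ∀ y, |f y| ≤ F) :
    ∃ D : ℝ, 0 ≤ D ∧ ∀ x ∈ S, ∀ y ∈ S, ∀ k : ℕ,
      (Tf T f)^[k] 0 y ≤ (Tf T f)^[k] 0 x + D := by
  have hacc : ∀ x ∈ S, ∀ y ∈ S, Acc' T x y := by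
    obtain ⟨z, rfl⟩ := hS
    intro x hx y hy
    exact Relation.ReflTransGen.trans hx.2 hy.1
  have key : ∀ x y : X, ∃ B : ℝ, x ∈ S → y ∈ S → ∀ k : ℕ,
      (∀ z ∈ S, (Tf T f)^[k] 0 x ≤ (Tf T f)^[k] 0 z) →
      (Tf T f)^[k] 0 y ≤ (Tf T f)^[k] 0 x + B := by
    intro x y
    by_cases hxy : x ∈ S ∧ y ∈ S
    · obtain ⟨A, B, h⟩ := acc_bound hT hcl hF hxy.1 (hacc x hxy.1 y hxy.2)
      refine ⟨B, fun _ _ k hm => ?_⟩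
      have := h k _ hm
      simp at this
      linarith
    · exact ⟨0, fun h1 h2 => absurd ⟨h1, h2⟩ hxy⟩
  choose B hB using key
  refine ⟨∑ x, ∑ y, |B x y|, by positivity, fun x hx y hy k => ?_⟩
  obtain ⟨w, hw, hmin⟩ := Set.exists_min_image S (fun z => (Tf T f)^[k] 0 z) S.toFinite hcl.1
  have h1 := hB w y hw hy k hmin
  have h2 := hmin x hx
  have h3 : |B w y| ≤ ∑ y, |B w y| :=
    Finset.single_le_sum (f := fun y => |B w y|) (fun _ _ => abs_nonneg _) (Finset.mem_univ y)
  have h4 : ∑ y, |B w y| ≤ ∑ x, ∑ y, |B x y| :=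
    Finset.single_le_sum (f := fun x => ∑ y, |B x y|)
      (fun _ _ => Finset.sum_nonneg fun _ _ => abs_nonneg _) (Finset.mem_univ w)
  have h5 := le_abs_self (B w y)
  linarith

end helpers

/-- for a closed communication class `S` of 𝒢(T̄), the upper expected
time averages started in `S` only depend on `f` through `f·𝟙_S`, and they converge
to a limit that is the same for all states in `S`. -/
theorem closed_commClass_average {X : Type*} [Fintype X] [Nonempty X]
    (T : (X → ℝ) → (X → ℝ)) (hT : IsUTO T) (S : Set X)
    (hS : IsCommClass T S) (hcl : ClosedIn T S) (f : X → ℝ) :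
    (∀ x ∈ S, ∀ k : ℕ, 1 ≤ k →
      (1 / (k : ℝ)) * (Tf T f)^[k] 0 x
        = (1 / (k : ℝ)) * (Tf T (f * ind S))^[k] 0 x) ∧
    ∃ μ : ℝ, ∀ x ∈ S,
      Tendsto (fun k : ℕ => (1 / (k : ℝ)) * (Tf T f)^[k] 0 x) atTop (𝓝 μ) := by
  constructor
  · intro x hx k _
    have e : ∀ y ∈ S, f y = (f * ind S) y := fun y hy => by simp [ind, hy]
    have h1 := iter_mono hT hcl (h := 0) (g := 0) (c := 0) e (by simp) k x hx
    have h2 := iter_mono hT hcl (h := 0) (g := 0) (c := 0)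
      (fun y hy => (e y hy).symm) (by simp) k x hx
    rw [add_zero] at h1 h2
    rw [le_antisymm h1 h2]
  · obtain ⟨F, hF⟩ : ∃ F : ℝ, ∀ y, |f y| ≤ F :=
      ⟨∑ y, |f y|, fun y => Finset.single_le_sum (f := fun y => |f y|)
        (fun _ _ => abs_nonneg _) (Finset.mem_univ y)⟩
    have hF0 : 0 ≤ F := (abs_nonneg _).trans (hF (Classical.arbitrary X))
    obtain ⟨D, hD, hosc⟩ := osc_bound hT hS hcl hF
    obtain ⟨z, hz⟩ := hcl.1
    let u : ℕ → ℝ := fun k => (Tf T f)^[k] 0 z + D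
    have hsub : Subadditive u := by
      intro k l
      have := iter_mono hT hcl (f := f) (f' := f) (h := (Tf T f)^[l] 0) (g := 0)
        (c := (Tf T f)^[l] 0 z + D) (fun _ _ => rfl)
        (fun y hy => by simpa using hosc z hz y hy l) k z hz
      rw [← Function.iterate_add_apply] at this
      simp only [u]
      linarith
    have hlow : ∀ k : ℕ, -F * k ≤ (Tf T f)^[k] 0 z := by
      intro k
      induction k with
      | zero => simp
      | succ k ih =>
        have := (iter_step hT hcl hF k z hz).2
        push_cast
        linarith
    have hbdd : BddBelow (Set.range fun n => u n / n) := by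
      refine ⟨-F, ?_⟩
      rintro _ ⟨n, rfl⟩
      rcases Nat.eq_zero_or_pos n with rfl | hn
      · simpa using hF0
      · have hn' : (0 : ℝ) < n := by exact_mod_cast hn
        simp only [u]
        rw [le_div_iff₀ hn']
        have := hlow n
        linarith
    have hlim := hsub.tendsto_lim hbdd
    refine ⟨hsub.lim, fun x hx => ?_⟩
    have h0 : Tendsto (fun n : ℕ => ((Tf T f)^[n] 0 x - u n) / n) atTop (𝓝 0) := by
      have hc : Tendsto (fun n : ℕ => (2 * D) / (n : ℝ)) atTop (𝓝 0) :=
        tendsto_const_div_atTop_nhds_zero_nat _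
      refine squeeze_zero_norm (fun n => ?_) hc
      rw [norm_div, Real.norm_natCast, Real.norm_eq_abs]
      refine div_le_div_of_nonneg_right ?_ (Nat.cast_nonneg n)
      have h1 := hosc x hx z hz n
      have h2 := hosc z hz x hx n
      simp only [u]
      rw [abs_le]
      constructor <;> linarith
    have h3 := hlim.add h0
    rw [add_zero] at h3
    refine h3.congr fun n => ?_
    ring

end WeakErg
end

section
/- Let T̄ be an upper transition operator on ℒ(X). If T̄ satisfies (TCA), then T̄ is weakly ergodic. -/
open Filter Topology

namespace WeakErg

section Aux

variable {X : Type*} [Fintype X] [Nonempty X] {T : (X → ℝ) → (X → ℝ)}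

lemma uto_mono_s8 (hT : IsUTO T) {h g : X → ℝ} (hg : ∀ x, h x ≤ g x) (x : X) :
    T h x ≤ T g x := by
  have h1 := hT.2.1 g (h - g) x
  have h2 := hT.1 (h - g) x
  have h3 : (⨆ y, (h - g) y) ≤ 0 := ciSup_le fun y => by
    simpa using hg y
  rw [add_sub_cancel] at h1
  linarith

lemma uto_add_le (hT : IsUTO T) (h : X → ℝ) (c : ℝ) (x : X) :
    T (fun y => h y + c) x ≤ T h x + c := by
  have h1 := hT.2.1 h (fun _ => c) x
  have h2 := hT.1 (fun _ => c) x
  rw [ciSup_const] at h2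
  have : (h + fun _ => c) = fun y => h y + c := rfl
  rw [this] at h1
  linarith

lemma uto_le_add (hT : IsUTO T) (h : X → ℝ) (c : ℝ) (x : X) :
    T h x + c ≤ T (fun y => h y + c) x := by
  have h1 := uto_add_le hT (fun y => h y + c) (-c) x
  simp only [add_neg_cancel_right] at h1
  linarith

lemma uto_smul (hT : IsUTO T) (h : X → ℝ) {l : ℝ} (hl : 0 ≤ l) (x : X) :
    T (fun y => l * h y) x = l * T h x := by
  have := congrFun (hT.2.2 l hl h) x
  exact this

lemma path_bound (hT : IsUTO T) {c : ℝ} {x y : X} (hxy : Acc' T x y) :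
    ∃ δ > 0, ∃ C : ℝ, ∀ (v : X → ℝ) (m : ℝ), (∀ z, T v z ≤ v z + c) → (∀ z, m ≤ v z) →
      m + δ * (v y - m) - C ≤ v x := by
  induction hxy using Relation.ReflTransGen.head_induction_on with
  | refl => exact ⟨1, one_pos, 0, fun v m _ _ => by linarith⟩
  | @head x z hxz _ ih =>
    obtain ⟨δ, hδ, C, ih⟩ := ih
    refine ⟨T (ind {z}) x * δ, mul_pos hxz hδ, T (ind {z}) x * C + c, fun v m hv hm => ?_⟩
    have h1 := ih v m hv hm
    have h0 : 0 ≤ v z - m := sub_nonneg.2 (hm z)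
    have h2 : T (fun w => (v z - m) * ind {z} w + m) x ≤ T v x := by
      apply uto_mono_s8 hT
      intro w
      by_cases hw : w = z
      · subst hw; simp [ind]
      · simpa [ind, hw] using hm w
    have h3 := uto_le_add hT (fun w => (v z - m) * ind {z} w) m x
    rw [uto_smul hT _ h0] at h3
    have h4 := hv x
    have h5 : T (ind {z}) x * (δ * (v y - m) - C) ≤ T (ind {z}) x * (v z - m) :=
      mul_le_mul_of_nonneg_left (by linarith) (le_of_lt hxz)
    nlinarith

lemma iter_lower (hT : IsUTO T) {c : ℝ} (v : X → ℝ) (hv : ∀ z, v z ≤ T v z + c) (n : ℕ) :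
    ∀ x, v x ≤ T^[n] v x + n * c := by
  induction n with
  | zero => simp
  | succ n ih =>
    intro x
    rw [Function.iterate_succ_apply']
    have h1 := uto_mono_s8 hT ih x
    have h2 := uto_add_le hT (T^[n] v) (n * c) x
    have h3 := hv x
    push_cast
    linarith

lemma iter_upper (hT : IsUTO T) (v g : X → ℝ) (a b : ℝ) (hb : 0 ≤ b)
    (hv : ∀ z, v z ≤ b * g z + a) (n : ℕ) :
    ∀ x, T^[n] v x ≤ b * T^[n] g x + a := by
  induction n with
  | zero => simpa using hv
  | succ n ih =>
    intro x
    rw [Function.iterate_succ_apply', Function.iterate_succ_apply']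
    have h1 := uto_mono_s8 hT ih x
    have h2 := uto_add_le hT (fun z => b * T^[n] g z) a x
    rw [uto_smul hT _ hb] at h2
    linarith

lemma low_bound (hT : IsUTO T) (c : ℝ) {R : Set X} (hR : ∀ x : X, ∀ y ∈ R, Acc' T x y) :
    ∃ C : ℝ, ∀ v : X → ℝ, (∀ z, T v z ≤ v z + c) → ∀ x, ∀ y ∈ R, v y ≤ v x + C := by
  have key : ∀ p : X × X, ∃ C : ℝ, p.2 ∈ R → ∀ v : X → ℝ, (∀ z, T v z ≤ v z + c) →
      (∀ z, v p.1 ≤ v z) → v p.2 ≤ v p.1 + C := by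
    rintro ⟨x, y⟩
    by_cases hy : y ∈ R
    · obtain ⟨δ, hδ, C, h⟩ := path_bound hT (c := c) (hR x y hy)
      refine ⟨C / δ, fun _ v hv hm => ?_⟩
      have h1 := h v (v x) hv hm
      have : v y - v x ≤ C / δ := by
        rw [le_div_iff₀ hδ]; linarith
      show v y ≤ v x + C / δ
      linarith
    · exact ⟨0, fun h => absurd h hy⟩
  choose C hC using key
  obtain ⟨B, hB⟩ := (Set.finite_range C).bddAbove
  refine ⟨B, fun v hv x y hy => ?_⟩
  obtain ⟨x0, hx0⟩ := Finite.exists_min v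
  have h1 := hC (x0, y) hy v hv hx0
  have h2 : C (x0, y) ≤ B := hB ⟨_, rfl⟩
  have h3 := hx0 x
  simp only at h1
  linarith

lemma span_bound (hT : IsUTO T) (htca : TCA T) (c : ℝ) :
    ∃ D : ℝ, ∀ v : X → ℝ, (∀ z, T v z ≤ v z + c) → (∀ z, v z ≤ T v z + c) →
      ∀ x y, v x ≤ v y + D := by
  obtain ⟨R, ⟨_, hR⟩, hA⟩ := htca
  obtain ⟨C, hC⟩ := low_bound hT c hR
  have key : ∀ x : X, ∃ B : ℝ, ∀ v : X → ℝ, (∀ z, T v z ≤ v z + c) →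
      (∀ z, v z ≤ T v z + c) → (∀ z, v z ≤ v x) → ∀ y, v x ≤ v y + B := by
    intro x
    by_cases hx : x ∈ R
    · exact ⟨C, fun v h1 _ _ y => hC v h1 y x hx⟩
    · obtain ⟨n, hn⟩ := hA x hx
      set q := T^[n] (ind Rᶜ) x with hq
      refine ⟨C + max 0 (n * c / (1 - q)), fun v h1 h2 hm y => ?_⟩
      by_cases hle : v x ≤ v y + C
      · have := le_max_left 0 (n * c / (1 - q))
        linarith
      · push Not at hle
        have hb : 0 ≤ v x - (v y + C) := by linarith
        have h3 := iter_upper hT v (ind Rᶜ) (v y + C) (v x - (v y + C)) hb (by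
          intro z
          by_cases hz : z ∈ R
          · simpa [ind, hz] using hC v h1 y z hz
          · simpa [ind, hz] using hm z) n x
        have h4 := iter_lower hT v h2 n x
        rw [← hq] at h3
        have h5 : v x - (v y + C) ≤ n * c / (1 - q) := by
          rw [le_div_iff₀ (by linarith)]
          nlinarith
        have := le_max_right 0 (n * c / (1 - q))
        linarith
  choose B hB using key
  obtain ⟨D, hD⟩ := (Set.finite_range B).bddAbove
  refine ⟨D, fun v h1 h2 x y => ?_⟩
  obtain ⟨x0, hx0⟩ := Finite.exists_max v
  have h3 := hB x0 v h1 h2 hx0 y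
  have h4 : B x0 ≤ D := hD ⟨_, rfl⟩
  have h5 := hx0 x
  linarith

end Aux

/-- if `T̄` satisfies (TCA), then `T̄` is weakly ergodic. -/
theorem weaklyErgodic_of_TCA {X : Type*} [Fintype X] [Nonempty X]
    (T : (X → ℝ) → (X → ℝ)) (hT : IsUTO T) (htca : TCA T) :
    WeaklyErgodic T := by
  intro f
  obtain ⟨F, hF⟩ : ∃ F : ℝ, ∀ x, |f x| ≤ F := by
    obtain ⟨x0, hx0⟩ := Finite.exists_max (fun x => |f x|)
    exact ⟨_, hx0⟩
  set v : ℕ → X → ℝ := fun k => (Tf T f)^[k] 0 with hv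
  have v0 : ∀ x, v 0 x = 0 := fun x => rfl
  have vs : ∀ k x, v (k + 1) x = f x + T (v k) x := by
    intro k x
    simp only [hv]
    rw [Function.iterate_succ_apply']
    rfl
  have T0 : ∀ x, T (v 0) x = 0 := by
    intro x
    have := congrFun (hT.2.2 0 le_rfl (v 0)) x
    have h0 : (0 : ℝ) • v 0 = v 0 := by funext y; simp [v0]
    rw [h0] at this
    simpa using this
  have d1 : ∀ k x, v (k + 1) x ≤ v k x + F := by
    intro k
    induction k with
    | zero =>
      intro x
      have := abs_le.1 (hF x)
      rw [vs, T0, v0]; linarith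
    | succ k ih =>
      intro x
      have h1 := uto_mono_s8 hT ih x
      have h2 := uto_add_le hT (v k) F x
      rw [vs (k + 1), vs k]; linarith
  have d2 : ∀ k x, v k x ≤ v (k + 1) x + F := by
    intro k
    induction k with
    | zero =>
      intro x
      have := abs_le.1 (hF x)
      rw [vs, T0, v0]; linarith
    | succ k ih =>
      intro x
      have h1 := uto_mono_s8 hT ih x
      have h2 := uto_add_le hT (v (k + 1)) F x
      rw [vs (k + 1), vs k]; linarith
  obtain ⟨D, hD⟩ := span_bound hT htca (2 * F)
  have hspan : ∀ k x y, v k x ≤ v k y + D := by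
    intro k
    apply hD
    · intro z
      have := abs_le.1 (hF z)
      have h1 := d1 k z
      rw [vs] at h1; linarith
    · intro z
      have := abs_le.1 (hF z)
      have h1 := d2 k z
      rw [vs] at h1; linarith
  set M : ℕ → ℝ := fun k => ⨆ x, v k x with hM
  have leM : ∀ k x, v k x ≤ M k := fun k x => le_ciSup (Set.finite_range (v k)).bddAbove x
  have hadd : ∀ m n x, v (m + n) x ≤ v n x + M m := by
    intro m n
    induction n with
    | zero => intro x; rw [v0, add_zero]; linarith [leM m x]
    | succ n ih =>
      intro x
      have h1 := uto_mono_s8 hT ih x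
      have h2 := uto_add_le hT (v n) (M m) x
      rw [← add_assoc, vs, vs]; linarith
  have hsub : Subadditive M := by
    intro m n
    apply ciSup_le
    intro x
    linarith [hadd m n x, leM n x]
  have hlow : ∀ k x, -(k * F) ≤ v k x := by
    intro k
    induction k with
    | zero => intro x; rw [v0]; simp
    | succ k ih =>
      intro x
      have := d2 k x
      have := ih x
      push_cast; linarith
  obtain ⟨x0⟩ := ‹Nonempty X›
  have hF0 : 0 ≤ F := (abs_nonneg _).trans (hF x0)
  have hbdd : BddBelow (Set.range fun n => M n / n) := by
    refine ⟨-F, ?_⟩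
    rintro _ ⟨n, rfl⟩
    rcases Nat.eq_zero_or_pos n with rfl | hn
    · simpa using hF0
    · have hn' : (0 : ℝ) < n := by exact_mod_cast hn
      show -F ≤ M n / n
      rw [le_div_iff₀ hn']
      linarith [hlow n x0, leM n x0]
  have hlim := hsub.tendsto_lim hbdd
  refine ⟨hsub.lim, fun x => ?_⟩
  have hDk : Tendsto (fun k : ℕ => M k / k - D / k) atTop (𝓝 hsub.lim) := by
    simpa using hlim.sub (tendsto_const_div_atTop_nhds_zero_nat D)
  refine tendsto_of_tendsto_of_tendsto_of_le_of_le hDk hlim ?_ ?_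
  · intro k
    show M k / k - D / k ≤ 1 / (k : ℝ) * v k x
    rw [← sub_div, one_div, inv_mul_eq_div]
    apply div_le_div_of_nonneg_right _ (Nat.cast_nonneg k)
    haveI : Nonempty X := ⟨x0⟩
    have : M k ≤ v k x + D := ciSup_le fun y => hspan k y x
    linarith
  · intro k
    show 1 / (k : ℝ) * v k x ≤ M k / k
    rw [one_div, inv_mul_eq_div]
    exact div_le_div_of_nonneg_right (leM k x) (Nat.cast_nonneg k)

end WeakErg
end

section
/- Let 𝒯 be a nonempty, separately specified set of transition matrices on X with upper envelope T̄, and suppose the graph 𝒢(T̄) is strongly connected. Then the imprecise Markov chain under repetition independence associated with 𝒯 is weakly ergodic, and for every f ∈ ℒ(X) and every x ∈ X, the limits lim_{k→∞} sup_{T∈𝒯} (1/k)·[T_f^k(0)](x) and lim_{k→∞} (1/k)·[T̄_f^k(0)](x) both exist and are equal. -/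
open Filter Topology

namespace WeakErg

section helpers

variable {X : Type*} [Fintype X] [Nonempty X]

/-- Monotone and commuting with the addition of constants. -/
def Topical (G : (X → ℝ) → (X → ℝ)) : Prop :=
  (∀ h g : X → ℝ, (∀ x, h x ≤ g x) → ∀ x, G h x ≤ G g x) ∧
  (∀ (h : X → ℝ) (c : ℝ) (x : X), G (fun y => h y + c) x = G h x + c)

lemma apply_topical (T : TransMat X) : Topical T.apply := by
  refine ⟨fun h g hg x => ?_, fun h c x => ?_⟩
  · exact Finset.sum_le_sum fun y _ => mul_le_mul_of_nonneg_left (hg y) (T.nonneg x y)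
  · simp only [TransMat.apply, mul_add, Finset.sum_add_distrib]
    rw [← Finset.sum_mul, T.rowSum, one_mul]

lemma apply_const (T : TransMat X) (c : ℝ) (x : X) : T.apply (fun _ => c) x = c := by
  simp only [TransMat.apply]
  rw [← Finset.sum_mul, T.rowSum, one_mul]

lemma bdd_apply (𝒯 : Set (TransMat X)) (h : X → ℝ) (x : X) :
    BddAbove (Set.range fun T : 𝒯 => T.1.apply h x) := by
  refine ⟨‖h‖, ?_⟩
  rintro _ ⟨T, rfl⟩
  have := (apply_topical T.1).1 h (fun _ => ‖h‖)
    (fun y => (le_abs_self _).trans (norm_le_pi_norm h y)) x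
  rwa [apply_const] at this

lemma apply_le_env {𝒯 : Set (TransMat X)} {Tbar : (X → ℝ) → (X → ℝ)}
    (henv : IsUpperEnv 𝒯 Tbar) (T : TransMat X) (hT : T ∈ 𝒯) (h : X → ℝ) (x : X) :
    T.apply h x ≤ Tbar h x := by
  rw [henv]
  exact le_ciSup (bdd_apply 𝒯 h x) (⟨T, hT⟩ : 𝒯)

lemma env_topical {𝒯 : Set (TransMat X)} (hne : 𝒯.Nonempty) {Tbar : (X → ℝ) → (X → ℝ)}
    (henv : IsUpperEnv 𝒯 Tbar) : Topical Tbar := by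
  haveI : Nonempty 𝒯 := hne.to_subtype
  have mono : ∀ h g : X → ℝ, (∀ x, h x ≤ g x) → ∀ x, Tbar h x ≤ Tbar g x := by
    intro h g hg x
    rw [henv h]
    exact ciSup_le fun T => ((apply_topical T.1).1 h g hg x).trans
      (apply_le_env henv T.1 T.2 g x)
  have key : ∀ (h : X → ℝ) (c : ℝ) (x : X), Tbar (fun y => h y + c) x ≤ Tbar h x + c := by
    intro h c x
    rw [henv]
    refine ciSup_le fun T => ?_
    rw [(apply_topical T.1).2]
    linarith [apply_le_env henv T.1 T.2 h x]
  refine ⟨mono, fun h c x => le_antisymm (key h c x) ?_⟩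
  have := key (fun y => h y + c) (-c) x
  simp only [add_neg_cancel_right] at this
  change Tbar h x ≤ _ at this
  linarith

lemma env_zero {𝒯 : Set (TransMat X)} (hne : 𝒯.Nonempty) {Tbar : (X → ℝ) → (X → ℝ)}
    (henv : IsUpperEnv 𝒯 Tbar) (x : X) : Tbar 0 x = 0 := by
  haveI : Nonempty 𝒯 := hne.to_subtype
  rw [henv]
  simp [TransMat.apply]

lemma Topical.Tf {G : (X → ℝ) → (X → ℝ)} (hG : Topical G) (f : X → ℝ) :
    Topical (Tf G f) := by
  refine ⟨fun h g hg x => ?_, fun h c x => ?_⟩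
  · simpa [WeakErg.Tf] using hG.1 h g hg x
  · simp [WeakErg.Tf, hG.2, add_assoc]

lemma Topical.iter {G : (X → ℝ) → (X → ℝ)} (hG : Topical G) (k : ℕ) :
    Topical (G^[k]) := by
  induction k with
  | zero => exact ⟨fun h g hg x => hg x, fun h c x => rfl⟩
  | succ k ih =>
    refine ⟨fun h g hg x => ?_, fun h c x => ?_⟩
    · rw [Function.iterate_succ', Function.comp_apply, Function.comp_apply]
      exact hG.1 _ _ (ih.1 h g hg) x
    · rw [Function.iterate_succ', Function.comp_apply, Function.comp_apply, ← hG.2]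
      congr 1
      congr 1
      funext y
      exact ih.2 h c y

lemma Topical.nonexp {G : (X → ℝ) → (X → ℝ)} (hG : Topical G) (h g : X → ℝ) (x : X) :
    |G h x - G g x| ≤ ‖h - g‖ := by
  have h1 : ∀ y, |h y - g y| ≤ ‖h - g‖ := fun y => norm_le_pi_norm (h - g) y
  have a := hG.1 h (fun y => g y + ‖h - g‖) (fun y => by linarith [(abs_le.1 (h1 y)).2]) x
  have b := hG.1 g (fun y => h y + ‖h - g‖) (fun y => by linarith [(abs_le.1 (h1 y)).1]) x
  rw [hG.2] at a b
  rw [abs_le]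
  constructor <;> linarith

lemma Topical.lip {G : (X → ℝ) → (X → ℝ)} (hG : Topical G) : LipschitzWith 1 G := by
  refine LipschitzWith.of_dist_le_mul fun h g => ?_
  rw [dist_eq_norm, dist_eq_norm, NNReal.coe_one, one_mul, pi_norm_le_iff_of_nonneg (norm_nonneg _)]
  exact fun x => hG.nonexp h g x

lemma Topical.iter_le {G : (X → ℝ) → (X → ℝ)} (hG : Topical G) (h : X → ℝ) (c : ℝ)
    (hc : ∀ x, G h x ≤ h x + c) (k : ℕ) (x : X) : G^[k] h x ≤ h x + k * c := by
  induction k generalizing x with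
  | zero => simp
  | succ k ih =>
    rw [Function.iterate_succ', Function.comp_apply]
    have := hG.1 _ (fun y => h y + k * c) ih x
    rw [hG.2] at this
    push_cast
    linarith [hc x]

lemma Topical.le_iter {G : (X → ℝ) → (X → ℝ)} (hG : Topical G) (h : X → ℝ) (c : ℝ)
    (hc : ∀ x, h x + c ≤ G h x) (k : ℕ) (x : X) : h x + k * c ≤ G^[k] h x := by
  induction k generalizing x with
  | zero => simp
  | succ k ih =>
    rw [Function.iterate_succ', Function.comp_apply]
    have := hG.1 (fun y => h y + k * c) _ ih x
    rw [hG.2] at this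
    push_cast
    linarith [hc x]

lemma Topical.iter_zero_le {G : (X → ℝ) → (X → ℝ)} (hG : Topical G) (h : X → ℝ) (c B : ℝ)
    (h0 : ∀ x, 0 ≤ h x) (hB : ∀ x, h x ≤ B)
    (hc : ∀ x, G h x ≤ h x + c) (k : ℕ) (x : X) : G^[k] 0 x ≤ B + k * c := by
  have := (hG.iter k).1 0 h h0 x
  linarith [hG.iter_le h c hc k x, hB x]

lemma Topical.le_iter_zero {G : (X → ℝ) → (X → ℝ)} (hG : Topical G) (h : X → ℝ) (c B : ℝ)
    (h0 : ∀ x, 0 ≤ h x) (hB : ∀ x, h x ≤ B)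
    (hc : ∀ x, h x + c ≤ G h x) (k : ℕ) (x : X) : k * c - B ≤ G^[k] 0 x := by
  have := (hG.iter k).1 h (fun y => (0 : X → ℝ) y + B) (fun y => by simpa using hB y) x
  rw [(hG.iter k).2] at this
  linarith [hG.le_iter h c hc k x, h0 x]

/-- Existence of discounted values. -/
lemma exists_disc {G : (X → ℝ) → (X → ℝ)} (hG : Topical G) (f : X → ℝ) (a : ℝ)
    (ha0 : 0 ≤ a) (ha1 : a < 1) : ∃ v : X → ℝ, ∀ x, v x = f x + a * G v x := by
  let F : (X → ℝ) → (X → ℝ) := fun v => f + a • G v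
  have hF : ContractingWith ⟨a, ha0⟩ F := by
    refine ⟨by exact_mod_cast ha1, LipschitzWith.of_dist_le_mul fun h g => ?_⟩
    have h1 := hG.lip.dist_le_mul h g
    simp only [F, dist_add_left, dist_smul₀, NNReal.coe_one, one_mul] at h1 ⊢
    rw [Real.norm_of_nonneg ha0]
    exact mul_le_mul_of_nonneg_left h1 ha0
  refine ⟨ContractingWith.fixedPoint F hF, fun x => ?_⟩
  exact (congrFun hF.fixedPoint_isFixedPt x).symm

lemma disc_bound {G : (X → ℝ) → (X → ℝ)} (hG : Topical G) (hG0 : ∀ x, G 0 x = 0)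
    (f : X → ℝ) (a : ℝ) (ha0 : 0 ≤ a) (v : X → ℝ)
    (hv : ∀ x, v x = f x + a * G v x) (ha1 : a < 1) (x : X) : |(1 - a) * v x| ≤ ‖f‖ := by
  have h1 : ‖v‖ ≤ ‖f‖ + a * ‖v‖ := by
    rw [pi_norm_le_iff_of_nonneg (by positivity)]
    intro y
    have h2 := hG.nonexp v 0 y
    rw [hG0, sub_zero, sub_zero] at h2
    rw [hv y, Real.norm_eq_abs]
    refine (abs_add_le _ _).trans (add_le_add (norm_le_pi_norm f y) ?_)
    rw [abs_mul, abs_of_nonneg ha0]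
    exact mul_le_mul_of_nonneg_left h2 ha0
  rw [abs_mul, abs_of_pos (by linarith)]
  have h3 : |v x| ≤ ‖v‖ := norm_le_pi_norm v x
  have h4 := mul_le_mul_of_nonneg_left h3 (show 0 ≤ 1 - a by linarith)
  linarith

lemma edge_delta {𝒯 : Set (TransMat X)} (hne : 𝒯.Nonempty) {Tbar : (X → ℝ) → (X → ℝ)}
    (henv : IsUpperEnv 𝒯 Tbar) {x y : X} (he : Edge Tbar x y) :
    ∃ d : ℝ, 0 < d ∧ ∀ h : X → ℝ, (∀ z, 0 ≤ h z) → d * h y ≤ Tbar h x := by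
  haveI : Nonempty 𝒯 := hne.to_subtype
  unfold Edge at he
  rw [henv] at he
  obtain ⟨T, hT⟩ := exists_lt_of_lt_ciSup he
  refine ⟨T.1.P x y, ?_, fun h hh => ?_⟩
  · classical
    simpa [TransMat.apply, ind, Set.indicator_apply] using hT
  · refine le_trans ?_ (apply_le_env henv T.1 T.2 h x)
    exact Finset.single_le_sum (f := fun z => T.1.P x z * h z)
      (fun z _ => mul_nonneg (T.1.nonneg x z) (hh z)) (Finset.mem_univ y)

lemma span_bound_s12 {𝒯 : Set (TransMat X)} (hne : 𝒯.Nonempty) {Tbar : (X → ℝ) → (X → ℝ)}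
    (henv : IsUpperEnv 𝒯 Tbar) (f : X → ℝ) (x0 x : X) (hacc : Acc' Tbar x0 x) :
    ∃ B : ℝ, ∀ (a : ℝ) (v : X → ℝ), 1 / 2 ≤ a → a < 1 → (∀ x, v x = f x + a * Tbar v x) →
      (∀ y, v x0 ≤ v y) → v x - v x0 ≤ B := by
  have hG := env_topical hne henv
  unfold Acc' at hacc
  induction hacc with
  | refl => exact ⟨0, fun a v _ _ _ _ => by simp⟩
  | @tail p q _ he ih =>
    obtain ⟨B, hB⟩ := ih
    obtain ⟨d, hd, hdd⟩ := edge_delta hne henv he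
    refine ⟨(B + 2 * ‖f‖) / (d / 2), fun a v ha ha1 hv hm => ?_⟩
    have h1 := hB a v ha ha1 hv hm
    have h2 := hdd (fun z => v z + -v x0) (fun z => by linarith [hm z])
    rw [hG.2] at h2
    have h3 := disc_bound hG (env_zero hne henv) f a (by linarith) v hv ha1 x0
    have h4 : |f p| ≤ ‖f‖ := norm_le_pi_norm f p
    have h5 := hv p
    rw [le_div_iff₀ (by positivity)]
    have h6 := mul_le_mul_of_nonneg_left h2 (show 0 ≤ a by linarith)
    have h7 : 1 / 2 * (d * (v q + -v x0)) ≤ a * (d * (v q + -v x0)) :=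
      mul_le_mul_of_nonneg_right ha (mul_nonneg hd.le (by linarith [hm q]))
    have h8 := (abs_le.1 h3).2
    have h9 := (abs_le.1 h4).1
    nlinarith

lemma exists_eig {𝒯 : Set (TransMat X)} (hne : 𝒯.Nonempty) {Tbar : (X → ℝ) → (X → ℝ)}
    (henv : IsUpperEnv 𝒯 Tbar) (hsc : StronglyConnected Tbar) (f : X → ℝ) :
    ∃ (h : X → ℝ) (μ B : ℝ), (∀ x, 0 ≤ h x) ∧ (∀ x, h x ≤ B) ∧
      ∀ x, Tf Tbar f h x = h x + μ := by
  have hG := env_topical hne henv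
  choose B hB using fun x0 x => span_bound_s12 hne henv f x0 x (hsc x0 x)
  let C : ℝ := ∑ p : X × X, |B p.1 p.2|
  have hC : ∀ x y, B x y ≤ C := fun x y => (le_abs_self _).trans
    (Finset.single_le_sum (f := fun p : X × X => |B p.1 p.2|)
      (fun p _ => abs_nonneg _) (Finset.mem_univ (x, y)))
  let a : ℕ → ℝ := fun n => 1 - 1 / ((n : ℝ) + 2)
  have ha : ∀ n, 1 / 2 ≤ a n := by
    intro n
    have : 1 / ((n : ℝ) + 2) ≤ 1 / 2 :=
      one_div_le_one_div_of_le (by norm_num) (by linarith [n.cast_nonneg (α := ℝ)])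
    simp only [a]; linarith
  have ha1 : ∀ n, a n < 1 := by
    intro n
    have : 0 < 1 / ((n : ℝ) + 2) := by positivity
    simp only [a]; linarith
  have hat : Tendsto a atTop (𝓝 1) := by
    have h1 : Tendsto (fun n : ℕ => 1 / ((n : ℝ) + 2)) atTop (𝓝 0) := by
      have := (tendsto_one_div_atTop_nhds_zero_nat (𝕜 := ℝ)).comp (tendsto_add_atTop_nat 2)
      refine this.congr fun n => ?_
      simp
    simpa [a] using h1.const_sub 1
  have step : ∀ n, ∃ w : (X → ℝ) × ℝ, w ∈ Set.Icc (fun _ => 0 : X → ℝ) (fun _ => C) ×ˢ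
      Set.Icc (-‖f‖) ‖f‖ ∧ ∀ x, w.1 x + w.2 = f x + a n * Tbar w.1 x := by
    intro n
    obtain ⟨v, hv⟩ := exists_disc hG f (a n) (by linarith [ha n]) (ha1 n)
    obtain ⟨x0, hx0⟩ := Finite.exists_min v
    refine ⟨(fun z => v z + -v x0, (1 - a n) * v x0), ⟨⟨fun z => ?_, fun z => ?_⟩, ?_⟩, ?_⟩
    · simpa using hx0 z
    · have := hB x0 z (a n) v (ha n) (ha1 n) hv hx0
      have := hC x0 z
      simp only
      linarith
    · exact abs_le.1 (disc_bound hG (env_zero hne henv) f (a n) (by linarith [ha n]) v hv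
        (ha1 n) x0)
    · intro x
      simp only
      rw [hG.2]
      linarith [hv x]
  choose w hw hweq using step
  obtain ⟨⟨h, μ⟩, hmem, φ, hφ, hlim⟩ :=
    (isCompact_Icc.prod isCompact_Icc).tendsto_subseq hw
  refine ⟨h, μ, C, hmem.1.1, hmem.1.2, fun x => ?_⟩
  have l1 : Tendsto (fun n => (w (φ n)).1) atTop (𝓝 h) :=
    (continuous_fst.tendsto _).comp hlim
  have l2 : Tendsto (fun n => (w (φ n)).2) atTop (𝓝 μ) :=
    (continuous_snd.tendsto _).comp hlim
  have l3 : Tendsto (fun n => Tbar (w (φ n)).1 x) atTop (𝓝 (Tbar h x)) :=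
    (((continuous_apply x).comp hG.lip.continuous).tendsto h).comp l1
  have l4 : Tendsto (fun n => (w (φ n)).1 x) atTop (𝓝 (h x)) :=
    ((continuous_apply x).tendsto h).comp l1
  have l5 := ((hat.comp hφ.tendsto_atTop).mul l3).const_add (f x)
  have l6 := tendsto_nhds_unique (l5.congr fun n => (hweq (φ n) x).symm) (l4.add l2)
  rw [one_mul] at l6
  exact l6

lemma exists_select {𝒯 : Set (TransMat X)} (hne : 𝒯.Nonempty) (hsep : SepSpec 𝒯)
    {Tbar : (X → ℝ) → (X → ℝ)}
    (henv : IsUpperEnv 𝒯 Tbar) (h : X → ℝ) (e : ℝ) (he : 0 < e) :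
    ∃ T ∈ 𝒯, ∀ x, Tbar h x - e ≤ T.apply h x := by
  classical
  haveI : Nonempty 𝒯 := hne.to_subtype
  suffices H : ∀ s : Finset X, ∃ T ∈ 𝒯, ∀ x ∈ s, Tbar h x - e ≤ T.apply h x by
    obtain ⟨T, hT, hh⟩ := H Finset.univ
    exact ⟨T, hT, fun x => hh x (Finset.mem_univ x)⟩
  intro s
  induction s using Finset.induction_on with
  | empty =>
    obtain ⟨T, hT⟩ := hne
    exact ⟨T, hT, by simp⟩
  | insert b s hb ih =>
    obtain ⟨T₂, hT₂, hh⟩ := ih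
    have : Tbar h b - e < ⨆ T : 𝒯, T.1.apply h b := by rw [← henv]; linarith
    obtain ⟨T₁, hT₁⟩ := exists_lt_of_lt_ciSup this
    obtain ⟨T₃, hT₃, e1, e2⟩ := hsep T₁.1 T₁.2 T₂ hT₂ {b}
    refine ⟨T₃, hT₃, fun x hx => ?_⟩
    by_cases hxb : x = b
    · subst hxb
      have : T₃.apply h x = T₁.1.apply h x := by simp [TransMat.apply, e1 x rfl]
      rw [this]; exact hT₁.le
    · have : T₃.apply h x = T₂.apply h x := by
        simp [TransMat.apply, e2 x (by simpa using hxb)]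
      rw [this]
      exact hh x ((Finset.mem_insert.1 hx).resolve_left hxb)

lemma main_aux (𝒯 : Set (TransMat X)) (hne : 𝒯.Nonempty) (hsep : SepSpec 𝒯)
    (Tbar : (X → ℝ) → (X → ℝ)) (henv : IsUpperEnv 𝒯 Tbar)
    (hsc : StronglyConnected Tbar) (f : X → ℝ) : ∃ μ : ℝ, ∀ x,
      Tendsto (riSeq 𝒯 f x) atTop (𝓝 μ) ∧
      Tendsto (fun k : ℕ => (1 / (k : ℝ)) * (Tf Tbar f)^[k] 0 x) atTop (𝓝 μ) := by
  haveI : Nonempty 𝒯 := hne.to_subtype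
  obtain ⟨h, μ, B, h0, hB, heq⟩ := exists_eig hne henv hsc f
  have hG := (env_topical hne henv).Tf f
  refine ⟨μ, fun x => ?_⟩
  have lB : Tendsto (fun k : ℕ => B / (k : ℝ)) atTop (𝓝 0) := tendsto_const_div_atTop_nhds_zero_nat B
  have lU : Tendsto (fun k : ℕ => B / (k : ℝ) + μ) atTop (𝓝 μ) := by simpa using lB.add_const μ
  have up : ∀ (G : (X → ℝ) → (X → ℝ)), Topical G → (∀ z, G h z ≤ h z + μ) → ∀ k : ℕ, 0 < k →
      (1 / (k : ℝ)) * G^[k] 0 x ≤ B / k + μ := by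
    intro G hG' hle k hk
    have hk' : (0 : ℝ) < k := by exact_mod_cast hk
    have := hG'.iter_zero_le h μ B h0 hB hle k x
    rw [one_div, inv_mul_le_iff₀ hk']
    field_simp
    linarith
  have low : ∀ (G : (X → ℝ) → (X → ℝ)) (c : ℝ), Topical G → (∀ z, h z + c ≤ G h z) →
      ∀ k : ℕ, 0 < k → c - B / k ≤ (1 / (k : ℝ)) * G^[k] 0 x := by
    intro G c hG' hle k hk
    have hk' : (0 : ℝ) < k := by exact_mod_cast hk
    have := hG'.le_iter_zero h c B h0 hB hle k x
    rw [one_div, le_inv_mul_iff₀ hk']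
    field_simp
    linarith
  have upT : ∀ T : 𝒯, ∀ k : ℕ, 0 < k →
      (1 / (k : ℝ)) * (Tf T.1.apply f)^[k] 0 x ≤ B / k + μ := by
    intro T
    refine up _ ((apply_topical T.1).Tf f) fun z => ?_
    rw [← heq z]
    simpa [Tf] using apply_le_env henv T.1 T.2 h z
  constructor
  · rw [tendsto_order]
    constructor
    · intro b hb
      obtain ⟨T, hT, hTe⟩ := exists_select hne hsep henv h ((μ - b) / 2) (by linarith)
      have l1 : Tendsto (fun k : ℕ => μ - (μ - b) / 2 - B / (k : ℝ)) atTop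
          (𝓝 (μ - (μ - b) / 2)) := by simpa using lB.const_sub (μ - (μ - b) / 2)
      filter_upwards [l1.eventually_const_lt (show b < μ - (μ - b) / 2 by linarith),
        eventually_gt_atTop 0] with k hk1 hk
      refine hk1.trans_le ?_
      refine (low (Tf T.apply f) _ ((apply_topical T).Tf f) (fun z => ?_) k hk).trans ?_
      · have h1 := heq z
        have h2 := hTe z
        simp only [Tf, Pi.add_apply] at h1 ⊢
        linarith
      · refine le_ciSup (f := fun T : 𝒯 => (1 / (k : ℝ)) * (Tf T.1.apply f)^[k] 0 x) ?_ ⟨T, hT⟩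
        refine ⟨B / k + μ, ?_⟩
        rintro _ ⟨S, rfl⟩
        exact upT S k hk
    · intro b hb
      filter_upwards [lU.eventually_lt_const hb, eventually_gt_atTop 0] with k hk1 hk
      exact (ciSup_le fun T => upT T k hk).trans_lt hk1
  · have lL : Tendsto (fun k : ℕ => μ - B / (k : ℝ)) atTop (𝓝 μ) := by
      simpa using lB.const_sub μ
    refine tendsto_of_tendsto_of_tendsto_of_le_of_le' lL lU ?_ ?_
    · filter_upwards [eventually_gt_atTop 0] with k hk
      exact low _ μ hG (fun z => (heq z).ge) k hk
    · filter_upwards [eventually_gt_atTop 0] with k hk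
      exact up _ hG (fun z => (heq z).le) k hk

end helpers

/-- if 𝒢(T̄) is strongly connected, then the imprecise Markov chain
under repetition independence associated with `𝒯` is weakly ergodic, and for every
`f` and `x` the limits of `sup_{T∈𝒯}(1/k)·[T_f^k(0)](x)` and of
`(1/k)·[T̄_f^k(0)](x)` both exist and coincide. -/
theorem ri_weaklyErgodic_of_stronglyConnected {X : Type*} [Fintype X] [Nonempty X]
    (𝒯 : Set (TransMat X)) (hne : 𝒯.Nonempty) (hsep : SepSpec 𝒯)
    (Tbar : (X → ℝ) → (X → ℝ)) (henv : IsUpperEnv 𝒯 Tbar)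
    (hsc : StronglyConnected Tbar) :
    RIWeaklyErgodic 𝒯 ∧
    ∀ (f : X → ℝ) (x : X), ∃ μ : ℝ,
      Tendsto (riSeq 𝒯 f x) atTop (𝓝 μ) ∧
      Tendsto (fun k : ℕ => (1 / (k : ℝ)) * (Tf Tbar f)^[k] 0 x) atTop (𝓝 μ) := by
  constructor
  · intro f
    obtain ⟨μ, hμ⟩ := main_aux 𝒯 hne hsep Tbar henv hsc f
    exact ⟨μ, fun x => (hμ x).1⟩
  · intro f x
    obtain ⟨μ, hμ⟩ := main_aux 𝒯 hne hsep Tbar henv hsc f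
    exact ⟨μ, hμ x⟩

end WeakErg
end
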